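/- Let $k$ be a field of prime characteristic $p$, with $H_n$ the $T$-space of $k_0\langle X\rangle$ generated by $x_1^p \cdots x_n^p$, and $S_1^{(p)}$ the $T$-space generated by the symmetrization $S^{(p)}$. Then for any $m \geq 1$: $(S_1^{(p)} H_{2m})^S \subseteq H_1 + H_{m+1}$ and $(H_{2m} S_1^{(p)})^S \subseteq H_1 + H_{m+1}$. -/

import Mathlib

open scoped BigOperators

/-- The free non-unital associative algebra over `k` on countably many variables,
realized as the semigroup algebra of the free semigroup on `ℕ`. -/
abbrev FA (k : Type*) [Field k] := MonoidAlgebra k (FreeSemigroup ℕ)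

/-- The generator (variable) `x_i`. -/
noncomputable def Xg (k : Type*) [Field k] (i : ℕ) : FA k :=
  MonoidAlgebra.single (FreeSemigroup.of i) 1

/-- Product of a (nonempty) list in a non-unital semiring; `0` on the empty list. -/
def lprod {A : Type*} [NonUnitalSemiring A] : List A → A
  | [] => 0
  | [a] => a
  | a :: b :: l => a * lprod (b :: l)

/-- `n`-th power in a non-unital semiring (zero for `n = 0`). -/
def npow' {A : Type*} [NonUnitalSemiring A] (a : A) (n : ℕ) : A :=
  lprod (List.replicate n a)

/-- The full multilinear symmetrization `S^{(d)}(y_1,…,y_d) = ∑_{σ ∈ Σ_d} y_{σ(1)} ⋯ y_{σ(d)}`. -/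
def Ssym {A : Type*} [NonUnitalSemiring A] (d : ℕ) (y : Fin d → A) : A :=
  ∑ σ : Equiv.Perm (Fin d), lprod (List.ofFn (fun i => y (σ i)))

/-- A T-space: a subspace closed under all substitution endomorphisms
(non-unital algebra endomorphisms). -/
def IsTSpace (k : Type*) [Field k] (V : Submodule k (FA k)) : Prop :=
  ∀ (φ : FA k →ₙₐ[k] FA k), ∀ v ∈ V, φ v ∈ V

/-- The T-space generated by a set `S`: the span of all substitution instances
of elements of `S`. -/
noncomputable def TSpan (k : Type*) [Field k] (S : Set (FA k)) : Submodule k (FA k) :=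
  Submodule.span k {a | ∃ (φ : FA k →ₙₐ[k] FA k) (s : FA k), s ∈ S ∧ a = φ s}

/-- The set of products `u * v` with `u ∈ U`, `v ∈ V`. -/
def mulSet {k : Type*} [Field k] (U V : Submodule k (FA k)) : Set (FA k) :=
  {a | ∃ u ∈ U, ∃ v ∈ V, a = u * v}

/-- The T-spaces `S_n^{(d)}`: `S_1^{(d)}` is generated by `S^{(d)}(x_1,…,x_d)` and
`S_{n+1}^{(d)} = (S_n^{(d)} S_1^{(d)})^S`. -/
noncomputable def Sn (k : Type*) [Field k] (d : ℕ) : ℕ → Submodule k (FA k)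
  | 0 => ⊥
  | 1 => TSpan k {Ssym d (fun i => Xg k i)}
  | (n+2) => TSpan k (mulSet (Sn k d (n+1)) (Sn k d 1))

/-- The T-spaces `H_n`: `H_1` is generated by `x_1^p` and `H_{n+1} = (H_n H_1)^S`. -/
noncomputable def Hn (k : Type*) [Field k] (p : ℕ) : ℕ → Submodule k (FA k)
  | 0 => ⊥
  | 1 => TSpan k {npow' (Xg k 0) p}
  | (n+2) => TSpan k (mulSet (Hn k p (n+1)) (Hn k p 1))

/-- The word `x_1^p x_2^p ⋯ x_n^p`. -/
noncomputable def hword (k : Type*) [Field k] (p n : ℕ) : FA k :=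
  lprod ((List.range n).map (fun t => npow' (Xg k t) p))

/-- The sum of the products of all rearrangements of a finite family in a (unital) ring. -/
def symProd {R : Type*} [Ring R] {d : ℕ} (y : Fin d → R) : R :=
  ∑ σ : Equiv.Perm (Fin d), (List.ofFn fun i => y (σ i)).prod

theorem univ_map_ofFn_perm (d : ℕ) :
    (Finset.univ : Finset (Equiv.Perm (Fin d))).val.map
        (fun σ : Equiv.Perm (Fin d) => List.ofFn fun i => σ i) =
      ((List.finRange d).permutations' : Multiset (List (Fin d))) := by
  apply Multiset.eq_of_le_of_card_le
  · rw [Multiset.le_iff_subset]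
    · intro l hl
      obtain ⟨σ, -, rfl⟩ := Multiset.mem_map.1 hl
      rw [Multiset.mem_coe, List.mem_permutations', ← List.ofFn_id]
      exact Equiv.Perm.ofFn_comp_perm σ id
    · refine Multiset.Nodup.map (fun σ τ h => ?_) Finset.univ.nodup
      exact DFunLike.coe_injective (List.ofFn_injective h)
  · rw [Multiset.coe_card, Multiset.card_map,
      ← (List.permutations_perm_permutations' (List.finRange d)).length_eq,
      List.length_permutations, List.length_finRange]
    simp [Fintype.card_perm]

section UnitalRing

variable {R : Type*} [Ring R]

theorem symProd_eq_permutations' {d : ℕ} (y : Fin d → R) :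
    symProd y = ((List.ofFn y).permutations'.map List.prod).sum := by
  have h := congrArg (fun s : Multiset (List (Fin d)) => (s.map fun l => (l.map y).prod).sum)
    (univ_map_ofFn_perm d)
  simp only [Multiset.map_map, Function.comp_def, List.map_ofFn, Multiset.map_coe,
    Multiset.sum_coe] at h
  rw [List.ofFn_eq_map, ← List.map_permutations', List.map_map]
  exact h

theorem symProd_cons_comm {d : ℕ} (a b : R) (x : Fin d → R) :
    symProd (Fin.cons a (Fin.cons b x) : Fin (d + 2) → R) =
      symProd (Fin.cons b (Fin.cons a x) : Fin (d + 2) → R) := by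
  simp only [symProd_eq_permutations', List.ofFn_cons]
  exact ((List.Perm.swap _ _ _).permutations'.map _).sum_eq

theorem sum_prod_permutations'Aux_right (w : R) {d : ℕ} (z : Fin d → R) :
    (((List.ofFn z).permutations'Aux w).map List.prod).sum =
      (List.ofFn z).prod * w +
        ∑ j, (List.ofFn (Function.update z j (w * z j))).prod := by
  induction d with
  | zero => simp
  | succ d ih =>
    have h := ih (fun i => z i.succ)
    have hu (j : Fin d) (i : Fin d) : Function.update z j.succ (w * z j.succ) i.succ =
        Function.update (fun i => z (Fin.succ i)) j (w * z j.succ) i := by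
      simp [Function.update_apply]
    rw [Fin.sum_univ_succ]
    simp only [List.ofFn_succ, List.permutations'Aux, List.map_cons, List.map_map, List.sum_cons,
      List.prod_cons, Function.comp_def, List.sum_map_mul_left, h, Function.update_self, hu,
      Function.update_of_ne (Fin.succ_ne_zero _), Function.update_of_ne (Fin.succ_ne_zero _).symm,
      ← Finset.mul_sum]
    noncomm_ring

theorem sum_prod_permutations'Aux_left (w : R) {d : ℕ} (z : Fin d → R) :
    (((List.ofFn z).permutations'Aux w).map List.prod).sum =
      w * (List.ofFn z).prod +
        ∑ j, (List.ofFn (Function.update z j (z j * w))).prod := by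
  induction d with
  | zero => simp
  | succ d ih =>
    have h := ih (fun i => z i.succ)
    have hu (j : Fin d) (i : Fin d) : Function.update z j.succ (z j.succ * w) i.succ =
        Function.update (fun i => z (Fin.succ i)) j (z j.succ * w) i := by
      simp [Function.update_apply]
    rw [Fin.sum_univ_succ]
    simp only [List.ofFn_succ, List.permutations'Aux, List.map_cons, List.map_map, List.sum_cons,
      List.prod_cons, Function.comp_def, List.sum_map_mul_left, h, Function.update_self, hu,
      Function.update_of_ne (Fin.succ_ne_zero _), Function.update_of_ne (Fin.succ_ne_zero _).symm,
      ← Finset.mul_sum]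
    noncomm_ring

theorem symProd_cons {d : ℕ} (w : R) (x : Fin d → R) :
    symProd (Fin.cons w x : Fin (d + 1) → R) =
      ∑ σ : Equiv.Perm (Fin d),
        (((List.ofFn fun i => x (σ i)).permutations'Aux w).map List.prod).sum := by
  have h := congrArg (fun s : Multiset (List (Fin d)) =>
    (s.map fun l => (((l.map x).permutations'Aux w).map List.prod).sum).sum)
    (univ_map_ofFn_perm d)
  simp only [Multiset.map_map, Function.comp_def, List.map_ofFn, Multiset.map_coe,
    Multiset.sum_coe] at h
  rw [symProd_eq_permutations', List.ofFn_cons, List.permutations', List.ofFn_eq_map,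
    ← List.map_permutations', List.flatMap_def, List.map_flatten,
    List.sum_flatten, List.map_map, List.map_map, List.map_map]
  exact h.symm

theorem sum_perm_update {d : ℕ} (x v : Fin d → R) :
    ∑ σ : Equiv.Perm (Fin d), ∑ j,
        (List.ofFn (Function.update (fun i => x (σ i)) j (v (σ j)))).prod =
      ∑ j, symProd (Function.update x j (v j)) := by
  simp only [symProd]
  rw [Finset.sum_comm (γ := Fin d)]
  refine Finset.sum_congr rfl fun σ _ => ?_
  refine (Finset.sum_congr rfl fun j _ => ?_).trans
    (Equiv.sum_comp σ fun j => (List.ofFn fun i => Function.update x j (v j) (σ i)).prod)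
  congr 2
  ext i
  simp [Function.update_apply]

theorem symProd_cons_eq_mul_right {d : ℕ} (w : R) (x : Fin d → R) :
    symProd (Fin.cons w x : Fin (d + 1) → R) =
      symProd x * w + ∑ j, symProd (Function.update x j (w * x j)) := by
  rw [symProd_cons, ← sum_perm_update x (fun j => w * x j), symProd, Finset.sum_mul,
    ← Finset.sum_add_distrib]
  exact Finset.sum_congr rfl fun σ _ => sum_prod_permutations'Aux_right w _

theorem symProd_cons_eq_mul_left {d : ℕ} (w : R) (x : Fin d → R) :
    symProd (Fin.cons w x : Fin (d + 1) → R) =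
      w * symProd x + ∑ j, symProd (Function.update x j (x j * w)) := by
  rw [symProd_cons, ← sum_perm_update x (fun j => x j * w), symProd, Finset.mul_sum,
    ← Finset.sum_add_distrib]
  exact Finset.sum_congr rfl fun σ _ => sum_prod_permutations'Aux_left w _

/-- The noncommutative polarization (Ryser) formula. -/
theorem symProd_eq_sum_powerset {d : ℕ} (y : Fin d → R) :
    symProd y = ∑ t ∈ (Finset.univ : Finset (Fin d)).powerset,
      (-1 : ℤ) ^ t.card • (∑ i ∈ tᶜ, y i) ^ d := by
  have h := Finset.inclusion_exclusion_sum_inf_compl (Finset.univ : Finset (Fin d))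
    (fun i => Finset.univ.filter fun f : Fin d → Fin d => ∀ j, f j ≠ i)
    (fun f => (List.ofFn fun j => y (f j)).prod)
  have hpow (t : Finset (Fin d)) : (∑ i ∈ tᶜ, y i) ^ d =
      ∑ f ∈ t.inf (fun i => Finset.univ.filter fun f : Fin d → Fin d => ∀ j, f j ≠ i),
        (List.ofFn fun j => y (f j)).prod := by
    have := (MultilinearMap.mkPiAlgebraFin ℤ d R).map_sum_finset
      (fun _ => y) (fun _ : Fin d => tᶜ)
    simp only [MultilinearMap.mkPiAlgebraFin_apply, List.ofFn_const, List.prod_replicate] at this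
    rw [this]
    refine Finset.sum_congr ?_ fun _ _ => rfl
    ext f
    simp only [Fintype.mem_piFinset, Finset.mem_compl, Finset.mem_inf, Finset.mem_filter,
      Finset.mem_univ, true_and]
    exact ⟨fun h i hi j e => h j (e ▸ hi), fun h j hj => h _ hj j rfl⟩
  simp only [hpow]
  rw [← h, symProd]
  refine Finset.sum_bij (fun σ _ => ⇑σ) ?_ ?_ ?_ ?_
  · intro σ _
    simp only [Finset.mem_inf, Finset.mem_compl, Finset.mem_filter, Finset.mem_univ, true_and]
    intro i _ hi
    exact hi (σ.symm i) (by simp)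
  · intro σ _ τ _ e
    exact DFunLike.coe_injective e
  · intro f hf
    simp only [Finset.mem_inf, Finset.mem_compl, Finset.mem_filter, Finset.mem_univ, true_and,
      not_forall, not_not, forall_const] at hf
    exact ⟨Equiv.ofBijective f (Finite.surjective_iff_bijective.1 hf), Finset.mem_univ _, rfl⟩
  · intro σ _
    rfl

end UnitalRing

theorem map_lprod {A R F : Type*} [NonUnitalRing A] [Ring R] [FunLike F A R]
    [NonUnitalRingHomClass F A R] (f : F) : ∀ {l : List A}, l ≠ [] → f (lprod l) = (l.map f).prod
  | [], h => absurd rfl h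
  | [a], _ => by simp [lprod]
  | a :: b :: l, _ => by
    rw [lprod, map_mul, map_lprod f (List.cons_ne_nil b l), List.map_cons (a := a), List.prod_cons]

theorem map_lprod_nonUnital {A B F : Type*} [NonUnitalRing A] [NonUnitalRing B] [FunLike F A B]
    [NonUnitalRingHomClass F A B] (f : F) : ∀ l : List A, f (lprod l) = lprod (l.map f)
  | [] => by simp [lprod]
  | [a] => by simp [lprod]
  | a :: b :: l => by
    rw [lprod, map_mul, map_lprod_nonUnital f (b :: l)]
    rfl

theorem map_npow' {A B F : Type*} [NonUnitalRing A] [NonUnitalRing B] [FunLike F A B]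
    [NonUnitalRingHomClass F A B] (f : F) (a : A) (n : ℕ) : f (npow' a n) = npow' (f a) n := by
  rw [npow', map_lprod_nonUnital, List.map_replicate, npow']

theorem map_Ssym {A B F : Type*} [NonUnitalRing A] [NonUnitalRing B] [FunLike F A B]
    [NonUnitalRingHomClass F A B] (f : F) (d : ℕ) (y : Fin d → A) :
    f (Ssym d y) = Ssym d fun i => f (y i) := by
  simp only [Ssym, map_sum, map_lprod_nonUnital, List.map_ofFn, Function.comp_def]

section NonUnitalRing

variable {A : Type*} [NonUnitalRing A]

theorem inr_Ssym {n : ℕ} (y : Fin (n + 1) → A) :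
    Unitization.inrNonUnitalAlgHom ℤ A (Ssym (n + 1) y) =
      symProd fun i => Unitization.inrNonUnitalAlgHom ℤ A (y i) := by
  simp only [Ssym, symProd, map_sum]
  refine Finset.sum_congr rfl fun σ _ => ?_
  rw [map_lprod _ (by simp), List.map_ofFn]
  rfl

theorem inrNonUnitalAlgHom_injective :
    Function.Injective (Unitization.inrNonUnitalAlgHom ℤ A) :=
  Unitization.inr_injective

theorem Ssym_exchange_right {n : ℕ} (a b : A) (x : Fin n → A) :
    Ssym (n + 1) (Fin.cons a x : Fin (n + 1) → A) * b +
        ∑ j, Ssym (n + 1) (Function.update (Fin.cons a x : Fin (n + 1) → A) j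
          (b * (Fin.cons a x : Fin (n + 1) → A) j)) =
      Ssym (n + 1) (Fin.cons b x : Fin (n + 1) → A) * a +
        ∑ j, Ssym (n + 1) (Function.update (Fin.cons b x : Fin (n + 1) → A) j
          (a * (Fin.cons b x : Fin (n + 1) → A) j)) := by
  apply inrNonUnitalAlgHom_injective
  let φ := Unitization.inrNonUnitalAlgHom ℤ A
  have h := (symProd_cons_eq_mul_right (φ b) (Fin.cons (φ a) (φ ∘ x) : Fin (n + 1) → _)).symm.trans
    ((symProd_cons_comm (φ b) (φ a) (φ ∘ x)).trans
      (symProd_cons_eq_mul_right (φ a) (Fin.cons (φ b) (φ ∘ x) : Fin (n + 1) → _)))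
  simp only [← Fin.comp_cons, Function.comp_apply, ← map_mul, ← Function.comp_update] at h
  simpa only [map_add, map_mul, map_sum, inr_Ssym, φ, Function.comp_def] using h

theorem Ssym_exchange_left {n : ℕ} (a b : A) (x : Fin n → A) :
    b * Ssym (n + 1) (Fin.cons a x : Fin (n + 1) → A) +
        ∑ j, Ssym (n + 1) (Function.update (Fin.cons a x : Fin (n + 1) → A) j
          ((Fin.cons a x : Fin (n + 1) → A) j * b)) =
      a * Ssym (n + 1) (Fin.cons b x : Fin (n + 1) → A) +
        ∑ j, Ssym (n + 1) (Function.update (Fin.cons b x : Fin (n + 1) → A) j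
          ((Fin.cons b x : Fin (n + 1) → A) j * a)) := by
  apply inrNonUnitalAlgHom_injective
  let φ := Unitization.inrNonUnitalAlgHom ℤ A
  have h := (symProd_cons_eq_mul_left (φ b) (Fin.cons (φ a) (φ ∘ x) : Fin (n + 1) → _)).symm.trans
    ((symProd_cons_comm (φ b) (φ a) (φ ∘ x)).trans
      (symProd_cons_eq_mul_left (φ a) (Fin.cons (φ b) (φ ∘ x) : Fin (n + 1) → _)))
  simp only [← Fin.comp_cons, Function.comp_apply, ← map_mul, ← Function.comp_update] at h
  simpa only [map_add, map_mul, map_sum, inr_Ssym, φ, Function.comp_def] using h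

theorem Ssym_eq_sum_npow' {n : ℕ} (y : Fin (n + 1) → A) :
    Ssym (n + 1) y = ∑ t ∈ (Finset.univ : Finset (Fin (n + 1))).powerset,
      (-1 : ℤ) ^ t.card • npow' (∑ i ∈ tᶜ, y i) (n + 1) := by
  apply inrNonUnitalAlgHom_injective
  rw [inr_Ssym, symProd_eq_sum_powerset, map_sum]
  refine Finset.sum_congr rfl fun t _ => ?_
  rw [map_zsmul, npow', map_lprod _ (by simp), List.map_replicate, List.prod_replicate, map_sum]

end NonUnitalRing

section TSpace

variable {k : Type*} [Field k]

theorem mem_TSpan {S : Set (FA k)} {s : FA k} (hs : s ∈ S) (φ : FA k →ₙₐ[k] FA k) :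
    φ s ∈ TSpan k S :=
  Submodule.subset_span ⟨φ, s, hs, rfl⟩

theorem subset_TSpan (S : Set (FA k)) : S ⊆ TSpan k S :=
  fun _ hs => mem_TSpan hs (NonUnitalAlgHom.id k (FA k))

theorem isTSpace_TSpan (S : Set (FA k)) : IsTSpace k (TSpan k S) := by
  intro φ v hv
  induction hv using Submodule.span_induction with
  | mem v h =>
    obtain ⟨ψ, s, hs, rfl⟩ := h
    exact mem_TSpan hs (φ.comp ψ)
  | zero => simp
  | add v w _ _ hv hw => rw [map_add]; exact add_mem hv hw
  | smul c v _ hv => rw [map_smul]; exact Submodule.smul_mem _ _ hv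

/-- The T-space generated by the products of two T-spaces is spanned by these products. -/
theorem TSpan_mulSet {U V : Submodule k (FA k)} (hU : IsTSpace k U) (hV : IsTSpace k V) :
    TSpan k (mulSet U V) = Submodule.span k (mulSet U V) := by
  apply le_antisymm
  · refine Submodule.span_le.2 ?_
    rintro _ ⟨φ, _, ⟨u, hu, v, hv, rfl⟩, rfl⟩
    exact Submodule.subset_span ⟨φ u, hU φ u hu, φ v, hV φ v hv, map_mul φ u v⟩
  · exact Submodule.span_le.2 (subset_TSpan _)

/-- The substitution endomorphism sending `x_i` to `f i`. -/
noncomputable def substHom (f : ℕ → FA k) : FA k →ₙₐ[k] FA k :=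
  MonoidAlgebra.liftMagma k (FreeSemigroup.lift f)

theorem substHom_Xg (f : ℕ → FA k) (i : ℕ) : substHom f (Xg k i) = f i := by
  simp [substHom, Xg]

theorem Ssym_mem_Sn (d : ℕ) (y : Fin d → FA k) : Ssym d y ∈ Sn k d 1 := by
  have h := mem_TSpan (Set.mem_singleton (Ssym d fun i : Fin d => Xg k i))
    (substHom fun i => if h : i < d then y ⟨i, h⟩ else 0)
  simpa [map_Ssym, substHom_Xg, Sn] using h

theorem npow'_mem_Hn (p : ℕ) (a : FA k) : npow' a p ∈ Hn k p 1 := by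
  have h := mem_TSpan (Set.mem_singleton (npow' (Xg k 0) p)) (substHom fun _ => a)
  rwa [map_npow', substHom_Xg, ← Hn] at h

theorem Sn_one_eq_span (d : ℕ) :
    Sn k d 1 = Submodule.span k (Set.range fun y : Fin d → FA k => Ssym d y) := by
  apply le_antisymm
  · rw [Sn, TSpan]
    refine Submodule.span_le.2 ?_
    rintro _ ⟨φ, _, rfl, rfl⟩
    exact Submodule.subset_span ⟨_, (map_Ssym φ d _).symm⟩
  · refine Submodule.span_le.2 ?_
    rintro _ ⟨y, rfl⟩
    exact Ssym_mem_Sn d y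

theorem Sn_one_le_Hn_one (n : ℕ) : Sn k (n + 1) 1 ≤ Hn k (n + 1) 1 := by
  rw [Sn_one_eq_span, Submodule.span_le]
  rintro _ ⟨y, rfl⟩
  simp only [Ssym_eq_sum_npow']
  exact sum_mem fun t _ => zsmul_mem (npow'_mem_Hn (k := k) _ _) _

theorem isTSpace_Hn (p : ℕ) : ∀ n, IsTSpace k (Hn k p n)
  | 0 => fun φ v hv => by
    rw [Hn, Submodule.mem_bot] at hv
    subst hv
    rw [map_zero]
    exact zero_mem _
  | 1 => by rw [Hn]; exact isTSpace_TSpan _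
  | _ + 2 => by rw [Hn]; exact isTSpace_TSpan _

theorem Hn_add_two (p n : ℕ) :
    Hn k p (n + 2) = Submodule.span k (mulSet (Hn k p (n + 1)) (Hn k p 1)) := by
  conv_lhs => rw [Hn]
  exact TSpan_mulSet (isTSpace_Hn (k := k) p (n + 1)) (isTSpace_Hn (k := k) p 1)

theorem mul_mem_Hn_right {p n : ℕ} (hn : 1 ≤ n) {a b : FA k} (ha : a ∈ Hn k p n)
    (hb : b ∈ Hn k p 1) : a * b ∈ Hn k p (n + 1) := by
  obtain ⟨n, rfl⟩ := Nat.exists_eq_add_of_le' hn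
  rw [Hn_add_two]
  exact Submodule.subset_span ⟨a, ha, b, hb, rfl⟩

theorem mul_mem_Hn_left {p n : ℕ} (hn : 1 ≤ n) {a b : FA k} (ha : a ∈ Hn k p 1)
    (hb : b ∈ Hn k p n) : a * b ∈ Hn k p (n + 1) := by
  induction n, hn using Nat.le_induction generalizing b with
  | base => exact mul_mem_Hn_right le_rfl ha hb
  | succ n hn ih =>
    obtain ⟨n, rfl⟩ := Nat.exists_eq_add_of_le' hn
    rw [Hn_add_two] at hb
    induction hb using Submodule.span_induction with
    | mem v h =>
      obtain ⟨u, hu, v, hv, rfl⟩ := h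
      rw [← mul_assoc]
      exact mul_mem_Hn_right (by omega) (ih hu) hv
    | zero => simp
    | add v w _ _ hv hw => rw [mul_add]; exact add_mem hv hw
    | smul c v _ hv => rw [mul_smul_comm]; exact Submodule.smul_mem _ _ hv

theorem Hn_add_le {p a b : ℕ} (ha : 1 ≤ a) (hb : 1 ≤ b) :
    Hn k p (a + b) ≤ Submodule.span k (mulSet (Hn k p a) (Hn k p b)) := by
  obtain ⟨a, rfl⟩ := Nat.exists_eq_add_of_le' ha
  induction b, hb using Nat.le_induction with
  | base => exact (Hn_add_two p a).le
  | succ b hb ih =>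
    rw [show a + 1 + (b + 1) = (a + b) + 2 by omega, Hn_add_two, Submodule.span_le]
    rintro _ ⟨u, hu, v, hv, rfl⟩
    have hu' := ih (show u ∈ Hn k p (a + 1 + b) by rwa [show a + 1 + b = a + b + 1 by omega])
    clear hu
    change u * v ∈ Submodule.span k _
    induction hu' using Submodule.span_induction with
    | mem u h =>
      obtain ⟨g, hg, h, hh, rfl⟩ := h
      exact Submodule.subset_span ⟨g, hg, h * v, mul_mem_Hn_right hb hh hv, mul_assoc g h v⟩
    | zero => simp
    | add u w _ _ hu hw => rw [add_mul]; exact add_mem hu hw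
    | smul c u _ hu => rw [smul_mul_assoc]; exact Submodule.smul_mem _ _ hu

theorem mul_mem_of_span {X Y : Set (FA k)} {W : Submodule k (FA k)}
    (h : ∀ x ∈ X, ∀ y ∈ Y, x * y ∈ W) {u v : FA k} (hu : u ∈ Submodule.span k X)
    (hv : v ∈ Submodule.span k Y) : u * v ∈ W := by
  induction hu using Submodule.span_induction with
  | mem x hx =>
    induction hv using Submodule.span_induction with
    | mem y hy => exact h x hx y hy
    | zero => simp
    | add v w _ _ hv hw => rw [mul_add]; exact add_mem hv hw
    | smul c v _ hv => rw [mul_smul_comm]; exact Submodule.smul_mem _ _ hv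
  | zero => simp
  | add u w _ _ hu hw => rw [add_mul]; exact add_mem hu hw
  | smul c u _ hu => rw [smul_mul_assoc]; exact Submodule.smul_mem _ _ hu

theorem exists_Ssym_mul_eq {n : ℕ} (a b : FA k) (x : Fin n → FA k) :
    ∃ s ∈ Sn k (n + 1) 1, Ssym (n + 1) (Fin.cons a x : Fin (n + 1) → FA k) * b =
      Ssym (n + 1) (Fin.cons b x : Fin (n + 1) → FA k) * a + s :=
  ⟨_, sub_mem (sum_mem fun _ _ => Ssym_mem_Sn _ _) (sum_mem fun _ _ => Ssym_mem_Sn _ _),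
    (eq_sub_of_add_eq (Ssym_exchange_right a b x)).trans (add_sub_assoc _ _ _)⟩

theorem exists_mul_Ssym_eq {n : ℕ} (a b : FA k) (x : Fin n → FA k) :
    ∃ s ∈ Sn k (n + 1) 1, b * Ssym (n + 1) (Fin.cons a x : Fin (n + 1) → FA k) =
      a * Ssym (n + 1) (Fin.cons b x : Fin (n + 1) → FA k) + s :=
  ⟨_, sub_mem (sum_mem fun _ _ => Ssym_mem_Sn _ _) (sum_mem fun _ _ => Ssym_mem_Sn _ _),
    (eq_sub_of_add_eq (Ssym_exchange_left a b x)).trans (add_sub_assoc _ _ _)⟩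

theorem Ssym_mul_mul_mem {n m : ℕ} (hm : 1 ≤ m) (y : Fin (n + 1) → FA k) {g h : FA k}
    (hg : g ∈ Hn k (n + 1) m) (hh : h ∈ Hn k (n + 1) m) :
    Ssym (n + 1) y * (g * h) ∈ Hn k (n + 1) 1 ⊔ Hn k (n + 1) (m + 1) := by
  have hSH := Sn_one_le_Hn_one (k := k) n
  obtain ⟨s, hs, h₁⟩ := exists_Ssym_mul_eq (y 0) g (Fin.tail y)
  obtain ⟨s', hs', h₂⟩ := exists_Ssym_mul_eq g (y 0 * h) (Fin.tail y)
  rw [Fin.cons_self_tail] at h₁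
  rw [← mul_assoc, h₁, add_mul, mul_assoc, h₂, add_right_comm, add_comm _ s']
  exact Submodule.add_mem_sup (hSH hs') (add_mem
    (mul_mem_Hn_left hm (hSH (Ssym_mem_Sn _ _)) hg) (mul_mem_Hn_left hm (hSH hs) hh))

theorem mul_mul_Ssym_mem {n m : ℕ} (hm : 1 ≤ m) (y : Fin (n + 1) → FA k) {g h : FA k}
    (hg : g ∈ Hn k (n + 1) m) (hh : h ∈ Hn k (n + 1) m) :
    (g * h) * Ssym (n + 1) y ∈ Hn k (n + 1) 1 ⊔ Hn k (n + 1) (m + 1) := by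
  have hSH := Sn_one_le_Hn_one (k := k) n
  obtain ⟨s, hs, h₁⟩ := exists_mul_Ssym_eq (y 0) h (Fin.tail y)
  obtain ⟨s', hs', h₂⟩ := exists_mul_Ssym_eq h (g * y 0) (Fin.tail y)
  rw [Fin.cons_self_tail] at h₁
  rw [mul_assoc, h₁, mul_add, ← mul_assoc, h₂, add_right_comm, add_comm _ s']
  exact Submodule.add_mem_sup (hSH hs') (add_mem
    (mul_mem_Hn_right hm hh (hSH (Ssym_mem_Sn _ _))) (mul_mem_Hn_right hm hg (hSH hs)))

end TSpace

/-- `(S_1^{(p)} H_{2m})^S ⊆ H_1 + H_{m+1}` and `(H_{2m} S_1^{(p)})^S ⊆ H_1 + H_{m+1}`. -/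
theorem h_base_case (k : Type*) [Field k] (p : ℕ) (hp : p.Prime) [CharP k p]
    (m : ℕ) (hm : 1 ≤ m) :
    TSpan k (mulSet (Sn k p 1) (Hn k p (2 * m))) ≤ Hn k p 1 ⊔ Hn k p (m + 1) ∧
    TSpan k (mulSet (Hn k p (2 * m)) (Sn k p 1)) ≤ Hn k p 1 ⊔ Hn k p (m + 1) := by
  obtain ⟨n, rfl⟩ := Nat.exists_eq_add_of_le' hp.one_le
  have hS : IsTSpace k (Sn k (n + 1) 1) := by rw [Sn]; exact isTSpace_TSpan _
  rw [TSpan_mulSet hS (isTSpace_Hn _ _), TSpan_mulSet (isTSpace_Hn _ _) hS, Submodule.span_le,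
    Submodule.span_le, two_mul]
  constructor
  · rintro _ ⟨u, hu, v, hv, rfl⟩
    rw [Sn_one_eq_span] at hu
    refine mul_mem_of_span ?_ hu (Hn_add_le hm hm hv)
    rintro _ ⟨y, rfl⟩ _ ⟨g, hg, h, hh, rfl⟩
    exact Ssym_mul_mul_mem hm y hg hh
  · rintro _ ⟨v, hv, u, hu, rfl⟩
    rw [Sn_one_eq_span] at hu
    refine mul_mem_of_span ?_ (Hn_add_le hm hm hv) hu
    rintro _ ⟨g, hg, h, hh, rfl⟩ _ ⟨y, rfl⟩
    exact mul_mul_Ssym_mem hm y hg hh
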